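/- Let A be a real n×n matrix and c a real 1×n row vector with (A,c) observable, and let k ∈ {1,…,n}. Then the observability operator O of (A,c) is strictly (k−1)-variation bounding if and only if there exists ε ∈ {−1,+1} such that for every integer N ≥ k, every r ∈ {1,…,k}, every t ∈ {1,…,N−k+1}, and every column index set β = {1,…,k−r̄} ∪ {t̄, t̄+1, …, t̄+r̄−1} with r̄ ∈ {1,…,k} and t̄ ∈ {k−r̄+1,…,n−r̄+1}, one has ε·det((O_N)_{α,β}) > 0, where α = {1,…,k−r} ∪ {k−r+t, k−r+t+1, …, k+t−1} and (O_N)_{α,β} denotes the submatrix of O_N with rows α and columns β. -/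

import Mathlib

open Matrix Polynomial Filter

noncomputable def signChanges (l : List ℝ) : ℕ :=
  (l.zip l.tail).countP (fun p => decide (p.1 * p.2 < 0))

/-- Variation `V(u)`: number of sign changes after deleting zero entries, `-1` for the
zero vector. -/
noncomputable def variation {m : ℕ} (u : Fin m → ℝ) : ℤ :=
  if ((List.ofFn u).filter fun x => decide (x ≠ 0)) = [] then -1
  else (signChanges ((List.ofFn u).filter fun x => decide (x ≠ 0)) : ℤ)

/-- Maximal variation `V_z(u)`: largest number of sign changes obtainable by replacing every
zero entry of `u` by an arbitrary nonzero real number. -/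
noncomputable def maxVariation {m : ℕ} (u : Fin m → ℝ) : ℤ :=
  sSup {v : ℤ | ∃ w : Fin m → ℝ, (∀ i, w i ≠ 0) ∧ (∀ i, u i ≠ 0 → w i = u i) ∧
    v = (signChanges (List.ofFn w) : ℤ)}

/-- `X` is strictly `k`-variation bounding. -/
def SVB {n m : ℕ} (X : Matrix (Fin n) (Fin m) ℝ) (k : ℕ) : Prop :=
  ∀ u : Fin m → ℝ, u ≠ 0 → variation u ≤ (k : ℤ) → maxVariation (X.mulVec u) ≤ (k : ℤ)

/-- `X` is `k`-variation bounding. -/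
def VB {n m : ℕ} (X : Matrix (Fin n) (Fin m) ℝ) (k : ℕ) : Prop :=
  ∀ u : Fin m → ℝ, u ≠ 0 → variation u ≤ (k : ℤ) → variation (X.mulVec u) ≤ (k : ℤ)

/-- `X` is `k`-variation diminishing. -/
def VD {n m : ℕ} (X : Matrix (Fin n) (Fin m) ℝ) (k : ℕ) : Prop :=
  ∀ j : ℕ, j ≤ k → VB X j

/-- `X` is strictly `k`-sign consistent: all `k×k` minors strictly positive, or all strictly
negative. -/
def SSC {n m : ℕ} (X : Matrix (Fin n) (Fin m) ℝ) (k : ℕ) : Prop :=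
  (∀ (f : Fin k → Fin n) (g : Fin k → Fin m), StrictMono f → StrictMono g →
    0 < (X.submatrix f g).det) ∨
  (∀ (f : Fin k → Fin n) (g : Fin k → Fin m), StrictMono f → StrictMono g →
    (X.submatrix f g).det < 0)

/-- `X` is `k`-sign consistent: all `k×k` minors nonnegative, or all nonpositive. -/
def SC {n m : ℕ} (X : Matrix (Fin n) (Fin m) ℝ) (k : ℕ) : Prop :=
  (∀ (f : Fin k → Fin n) (g : Fin k → Fin m), StrictMono f → StrictMono g →
    0 ≤ (X.submatrix f g).det) ∨
  (∀ (f : Fin k → Fin n) (g : Fin k → Fin m), StrictMono f → StrictMono g →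
    (X.submatrix f g).det ≤ 0)

/-- `X` is `k`-sign regular. -/
def SR {n m : ℕ} (X : Matrix (Fin n) (Fin m) ℝ) (k : ℕ) : Prop :=
  ∀ j : ℕ, 1 ≤ j → j ≤ k → SC X j

/-- `X` is strictly totally positive. -/
def STP {n m : ℕ} (X : Matrix (Fin n) (Fin m) ℝ) : Prop :=
  ∀ (j : ℕ) (f : Fin j → Fin n) (g : Fin j → Fin m), StrictMono f → StrictMono g →
    0 < (X.submatrix f g).det

/-- `X` is `k`-positive: all `j×j` minors nonnegative for `j = 1, …, k`. -/
def KPos {n m : ℕ} (X : Matrix (Fin n) (Fin m) ℝ) (k : ℕ) : Prop :=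
  ∀ j : ℕ, 1 ≤ j → j ≤ k → ∀ (f : Fin j → Fin n) (g : Fin j → Fin m),
    StrictMono f → StrictMono g → 0 ≤ (X.submatrix f g).det

/-- `X` is strictly `k`-positive: all `j×j` minors positive for `j = 1, …, k`. -/
def KPosStrict {n m : ℕ} (X : Matrix (Fin n) (Fin m) ℝ) (k : ℕ) : Prop :=
  ∀ j : ℕ, 1 ≤ j → j ≤ k → ∀ (f : Fin j → Fin n) (g : Fin j → Fin m),
    StrictMono f → StrictMono g → 0 < (X.submatrix f g).det

/-- The `t`-step observability matrix `O_t` with `i`-th row `c Aⁱ⁻¹`. -/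
noncomputable def obsMat {n : ℕ} (A : Matrix (Fin n) (Fin n) ℝ) (c : Fin n → ℝ) (t : ℕ) :
    Matrix (Fin t) (Fin n) ℝ :=
  Matrix.of fun i j => Matrix.vecMul c (A ^ (i : ℕ)) j

/-- The pair `(A, c)` is observable. -/
def Observable {n : ℕ} (A : Matrix (Fin n) (Fin n) ℝ) (c : Fin n → ℝ) : Prop :=
  (obsMat A c n).det ≠ 0

/-- The observability operator of `(A, c)` is strictly `k`-variation bounding. -/
def ObsSVB {n : ℕ} (A : Matrix (Fin n) (Fin n) ℝ) (c : Fin n → ℝ) (k : ℕ) : Prop :=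
  ∀ t : ℕ, 0 < t → SVB (obsMat A c t) k

/-- The observability operator of `(A, c)` is `k`-variation bounding. -/
def ObsVB {n : ℕ} (A : Matrix (Fin n) (Fin n) ℝ) (c : Fin n → ℝ) (k : ℕ) : Prop :=
  ∀ t : ℕ, 0 < t → VB (obsMat A c t) k

/-- The matrix `M_r[t]`: first `n - r` rows `c, cA, …, cA^{n-r-1}`, last `r` rows
`cA^{n-r+t-1}, …, cA^{n+t-2}`. -/
noncomputable def Mrt {n : ℕ} (A : Matrix (Fin n) (Fin n) ℝ) (c : Fin n → ℝ) (r t : ℕ) :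
    Matrix (Fin n) (Fin n) ℝ :=
  Matrix.of fun i j =>
    Matrix.vecMul c (A ^ (if (i : ℕ) < n - r then (i : ℕ) else (i : ℕ) + t - 1)) j

/-- `y` takes strictly alternating signs along some `k + 1` increasing indices. -/
def Alternates {ι : Type*} [Preorder ι] (y : ι → ℝ) (k : ℕ) : Prop :=
  ∃ s : Fin (k + 1) → ι, StrictMono s ∧ ∃ σ : ℝ, σ ≠ 0 ∧
    ∀ j : Fin (k + 1), 0 < σ * (-1) ^ (j : ℕ) * y (s j)

/-- `y` takes weakly alternating signs along some `k + 1` increasing indices. -/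
def WeaklyAlternates {ι : Type*} [Preorder ι] (y : ι → ℝ) (k : ℕ) : Prop :=
  ∃ s : Fin (k + 1) → ι, StrictMono s ∧ ∃ σ : ℝ, σ ≠ 0 ∧
    ∀ j : Fin (k + 1), 0 ≤ σ * (-1) ^ (j : ℕ) * y (s j)

theorem signChanges_cons_cons (a b : ℝ) (l : List ℝ) :
    signChanges (a :: b :: l) = signChanges (b :: l) + if a * b < 0 then 1 else 0 := by
  simp [signChanges, List.countP_cons]

theorem mul_neg_iff_of_mul_pos {a b : ℝ} (hab : 0 < a * b) (c : ℝ) : c * a < 0 ↔ c * b < 0 := by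
  rcases pos_and_pos_or_neg_and_neg_of_mul_pos hab with ⟨ha, hb⟩ | ⟨ha, hb⟩
  · rw [← neg_pos, ← neg_pos (a := c * b), ← neg_mul, ← neg_mul, mul_pos_iff_of_pos_right ha,
      mul_pos_iff_of_pos_right hb]
  · rw [← neg_pos, ← neg_pos (a := c * b), ← mul_neg, ← mul_neg,
      mul_pos_iff_of_pos_right (neg_pos.2 ha), mul_pos_iff_of_pos_right (neg_pos.2 hb)]

theorem exists_isChain_sublist (l : List ℝ) :
    ∀ a : ℝ, (∀ x ∈ a :: l, x ≠ 0) → ∃ c l', (c :: l').Sublist (a :: l) ∧ 0 < c * a ∧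
      l'.length = signChanges (a :: l) ∧ (c :: l').IsChain (fun x y => x * y < 0) := by
  induction l with
  | nil =>
    intro a ha
    exact ⟨a, [], List.Sublist.refl _, by simpa using ha a, by simp [signChanges], by simp⟩
  | cons b t ih =>
    intro a ha
    have hane : a ≠ 0 := ha a (by simp)
    have hb : b ≠ 0 := ha b (by simp)
    obtain ⟨c, l', hsub, hcb, hlen, hch⟩ := ih b fun x hx => ha x (List.mem_cons_of_mem _ hx)
    rw [signChanges_cons_cons]
    by_cases hab : a * b < 0
    · refine ⟨a, c :: l', hsub.cons_cons a, mul_self_pos.2 hane, by simp [hlen, hab], ?_⟩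
      rw [List.isChain_cons_cons]
      exact ⟨(mul_neg_iff_of_mul_pos hcb a).2 hab, hch⟩
    · have hab' : 0 < a * b := lt_of_le_of_ne (not_lt.1 hab) (mul_ne_zero hane hb).symm
      refine ⟨c, l', hsub.cons a, ?_, by simp [hlen, hab], hch⟩
      by_contra h
      have hca : c * a < 0 := lt_of_le_of_ne (not_lt.1 h)
        (mul_ne_zero (left_ne_zero_of_mul hcb.ne') hane)
      exact absurd ((mul_neg_iff_of_mul_pos hab' c).1 hca) hcb.not_gt

theorem length_le_signChanges (l : List ℝ) : ∀ a : ℝ, (∀ x ∈ a :: l, x ≠ 0) → ∀ l' : List ℝ,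
    l'.Sublist (a :: l) → l'.IsChain (fun x y => x * y < 0) →
      l'.length ≤ signChanges (a :: l) + 1 ∧
      ∀ c l'', l' = c :: l'' → c * a < 0 → l'.length ≤ signChanges (a :: l) := by
  induction l with
  | nil =>
    intro a ha l' hsub _
    have h1 := hsub.length_le
    refine ⟨by simp at h1; omega, ?_⟩
    rintro c l'' rfl hca
    have : c = a := by
      have := hsub.subset (List.mem_cons_self)
      simpa using this
    subst this
    nlinarith [mul_self_nonneg c]
  | cons b t ih =>
    intro a ha l' hsub hch
    have hane : a ≠ 0 := ha a (by simp)
    have hb : b ≠ 0 := ha b (by simp)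
    have ih := ih b fun x hx => ha x (List.mem_cons_of_mem _ hx)
    rw [signChanges_cons_cons]
    rcases List.sublist_cons_iff.1 hsub with h | ⟨r, rfl, h⟩
    · obtain ⟨h1, h2⟩ := ih l' h hch
      split_ifs with hab
      · exact ⟨by omega, fun _ _ _ _ => h1⟩
      · have hab' : 0 < a * b := lt_of_le_of_ne (not_lt.1 hab) (mul_ne_zero hane hb).symm
        exact ⟨by omega, fun c l'' hl hc => h2 c l'' hl ((mul_neg_iff_of_mul_pos hab' c).1 hc)⟩
    · obtain ⟨h1, h2⟩ := ih r h hch.tail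
      refine ⟨?_, ?_⟩
      · split_ifs with hab
        · simp; omega
        · have hab' : 0 < a * b := lt_of_le_of_ne (not_lt.1 hab) (mul_ne_zero hane hb).symm
          cases r with
          | nil => simp
          | cons c r =>
            have hac := (List.isChain_cons_cons.1 hch).1
            have := h2 c r rfl ((mul_neg_iff_of_mul_pos hab' c).1 (by linarith))
            simp at this ⊢; omega
      · intro c l'' hl hc
        obtain ⟨rfl, -⟩ := List.cons.inj hl
        nlinarith [mul_self_nonneg a]

theorem exists_fin_of_isChain_sublist {m k : ℕ} (u : Fin m → ℝ) {l : List ℝ}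
    (hl : l.length = k + 1) (hsub : l.Sublist (List.ofFn u))
    (hch : l.IsChain (fun x y => x * y < 0)) :
    ∃ s : Fin (k + 1) → Fin m, StrictMono s ∧
      ∀ j : Fin k, u (s j.castSucc) * u (s j.succ) < 0 := by
  obtain ⟨f, hf⟩ := List.sublist_iff_exists_fin_orderEmbedding_get_eq.1 hsub
  have hget : ∀ j : Fin (k + 1),
      u (Fin.cast (by simp) (f (Fin.cast hl.symm j))) = l.get (Fin.cast hl.symm j) := by
    intro j
    rw [hf]
    simp
    rfl
  refine ⟨fun j => Fin.cast (by simp) (f (Fin.cast hl.symm j)), ?_, ?_⟩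
  · intro i j hij
    have : f (Fin.cast hl.symm i) < f (Fin.cast hl.symm j) := f.strictMono (by simpa using hij)
    simpa using this
  · intro j
    rw [hget, hget]
    exact List.isChain_iff_getElem.1 hch j (by simp [hl])

theorem alternates_iff_consecutive {ι : Type*} [Preorder ι] (y : ι → ℝ) {k : ℕ} (hk : 1 ≤ k) :
    Alternates y k ↔ ∃ s : Fin (k + 1) → ι, StrictMono s ∧
      ∀ j : Fin k, y (s j.castSucc) * y (s j.succ) < 0 := by
  constructor
  · rintro ⟨s, hs, σ, hσ, h⟩
    refine ⟨s, hs, fun j => ?_⟩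
    have h1 := mul_pos (h j.castSucc) (h j.succ)
    have h2 : ((-1 : ℝ) ^ (j : ℕ)) ^ 2 = 1 := by rw [← pow_mul, mul_comm, pow_mul]; simp
    have h3 : 0 < -(σ ^ 2 * (y (s j.castSucc) * y (s j.succ))) := by
      calc (0 : ℝ) < _ := h1
        _ = -(σ ^ 2 * (y (s j.castSucc) * y (s j.succ))) * ((-1 : ℝ) ^ (j : ℕ)) ^ 2 := by
          simp [pow_succ]; ring
        _ = _ := by rw [h2, mul_one]
    have : 0 < σ ^ 2 := by positivity
    by_contra hc
    nlinarith [mul_nonneg this.le (not_lt.1 hc)]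
  · rintro ⟨s, hs, h⟩
    have h0 : y (s 0) ≠ 0 := by
      have := h ⟨0, hk⟩
      intro h0
      rw [show (Fin.castSucc (⟨0, hk⟩ : Fin k)) = 0 from rfl, h0] at this
      simp at this
    refine ⟨s, hs, y (s 0), h0, fun j => ?_⟩
    induction j using Fin.induction with
    | zero => simpa using mul_self_pos.2 h0
    | succ j ih =>
      have h1 := h j
      simp only [Fin.val_castSucc] at ih
      simp only [Fin.val_succ, pow_succ]
      have h2 : 0 < -((y (s 0) * (-1) ^ (j : ℕ) * y (s j.castSucc)) *
          (y (s j.castSucc) * y (s j.succ))) := by nlinarith [mul_pos ih (neg_pos.2 h1)]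
      have h3 : 0 < y (s j.castSucc) ^ 2 := by
        have : y (s j.castSucc) ≠ 0 := left_ne_zero_of_mul h1.ne
        positivity
      by_contra hc
      nlinarith [mul_nonneg h3.le (neg_nonneg.2 (not_lt.1 hc))]

theorem le_signChanges_filter_iff {m k : ℕ} (hk : 1 ≤ k) (u : Fin m → ℝ) :
    k ≤ signChanges ((List.ofFn u).filter fun x => decide (x ≠ 0)) ↔ Alternates u k := by
  rw [alternates_iff_consecutive u hk]
  have hne : ∀ x ∈ (List.ofFn u).filter fun x => decide (x ≠ 0), x ≠ 0 := by
    intro x hx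
    simpa using (List.mem_filter.1 hx).2
  have hsl : ((List.ofFn u).filter fun x => decide (x ≠ 0)).Sublist (List.ofFn u) :=
    List.filter_sublist
  constructor
  · intro h
    generalize (List.ofFn u).filter (fun x => decide (x ≠ 0)) = l at *
    cases l with
    | nil => simp [signChanges] at h; omega
    | cons a t =>
      obtain ⟨c, l', hsub, -, hlen, hch⟩ := exists_isChain_sublist t a hne
      refine exists_fin_of_isChain_sublist u (l := (c :: l').take (k + 1)) ?_
        (((List.take_sublist _ _).trans hsub).trans hsl) (hch.take _)
      simp; omega
  · rintro ⟨s, hs, h⟩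
    have hch : (List.ofFn (u ∘ s)).IsChain (fun x y => x * y < 0) := by
      rw [List.isChain_iff_getElem]
      intro i hi
      simp only [List.length_ofFn] at hi
      simp only [List.getElem_ofFn]
      exact h ⟨i, by omega⟩
    have hnz : ∀ j, u (s j) ≠ 0 := by
      intro j
      induction j using Fin.cases with
      | zero => exact left_ne_zero_of_mul (h ⟨0, hk⟩).ne
      | succ j => exact right_ne_zero_of_mul (h j).ne
    have hsub : (List.ofFn (u ∘ s)).Sublist (List.ofFn u) := by
      rw [List.sublist_iff_exists_fin_orderEmbedding_get_eq]
      refine ⟨OrderEmbedding.ofStrictMono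
        (fun i => Fin.cast (by simp) (s (Fin.cast (by simp) i))) ?_, ?_⟩
      · intro i j hij
        have := @hs (Fin.cast (by simp) i) (Fin.cast (by simp) j) (by simpa using hij)
        simpa using this
      · intro i
        simp only [List.get_ofFn]
        rfl
    have hsub' := hsub.filter (fun x => decide (x ≠ 0))
    have hself : (List.ofFn (u ∘ s)).filter (fun x => decide (x ≠ 0)) = List.ofFn (u ∘ s) := by
      rw [List.filter_eq_self]
      intro x hx
      obtain ⟨j, rfl⟩ := List.mem_ofFn.1 hx
      simpa using hnz j
    rw [hself] at hsub'
    generalize (List.ofFn u).filter (fun x => decide (x ≠ 0)) = l at *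
    cases l with
    | nil => simpa using hsub'.length_le
    | cons a t =>
      have := (length_le_signChanges t a hne _ hsub' hch).1
      simpa using this

theorem le_variation_iff {m k : ℕ} (hk : 1 ≤ k) (u : Fin m → ℝ) :
    (k : ℤ) ≤ variation u ↔ Alternates u k := by
  rw [← le_signChanges_filter_iff hk, variation]
  split_ifs with h
  · rw [h]
    simp [signChanges]
    omega
  · exact Nat.cast_le

theorem le_signChanges_ofFn_iff {m k : ℕ} (hk : 1 ≤ k) {w : Fin m → ℝ} (hw : ∀ i, w i ≠ 0) :
    k ≤ signChanges (List.ofFn w) ↔ Alternates w k := by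
  rw [← le_signChanges_filter_iff hk, List.filter_eq_self.2]
  simpa [List.mem_ofFn] using hw

theorem signChanges_le_length (l : List ℝ) : signChanges l ≤ l.length := by
  refine List.countP_le_length.trans ?_
  simp

theorem le_maxVariation_iff {m k : ℕ} (hk : 1 ≤ k) (y : Fin m → ℝ) :
    (k : ℤ) ≤ maxVariation y ↔ WeaklyAlternates y k := by
  have hbdd : BddAbove {v : ℤ | ∃ w : Fin m → ℝ, (∀ i, w i ≠ 0) ∧ (∀ i, y i ≠ 0 → w i = y i) ∧
      v = (signChanges (List.ofFn w) : ℤ)} := by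
    refine ⟨m, ?_⟩
    rintro _ ⟨w, -, -, rfl⟩
    simpa using signChanges_le_length (List.ofFn w)
  constructor
  · intro h
    have hne : {v : ℤ | ∃ w : Fin m → ℝ, (∀ i, w i ≠ 0) ∧ (∀ i, y i ≠ 0 → w i = y i) ∧
        v = (signChanges (List.ofFn w) : ℤ)}.Nonempty := by
      refine ⟨_, fun i => if y i = 0 then 1 else y i, fun i => ?_, fun i hi => ?_, rfl⟩
      · dsimp only; split_ifs with h <;> simp [h]
      · simp [hi]
    obtain ⟨w, hw, hwy, hv⟩ := Int.csSup_mem hne hbdd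
    rw [maxVariation, hv, Nat.cast_le, le_signChanges_ofFn_iff hk hw] at h
    obtain ⟨s, hs, σ, hσ, h⟩ := h
    refine ⟨s, hs, σ, hσ, fun j => ?_⟩
    by_cases hj : y (s j) = 0
    · simp [hj]
    · rw [← hwy _ hj]; exact (h j).le
  · rintro ⟨s, hs, σ, hσ, h⟩
    classical
    set w : Fin m → ℝ := fun i => if y i = 0 then
      (if hi : ∃ j, s j = i then σ * (-1) ^ (hi.choose : ℕ) else 1) else y i with hwdef
    have hw : ∀ i, w i ≠ 0 := by
      intro i
      simp only [hwdef]
      split_ifs with h1 h2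
      · exact mul_ne_zero hσ (by simp)
      · exact one_ne_zero
      · exact h1
    have hws : ∀ j : Fin (k + 1), 0 < σ * (-1) ^ (j : ℕ) * w (s j) := by
      intro j
      by_cases hj : y (s j) = 0
      · have hex : ∃ j', s j' = s j := ⟨j, rfl⟩
        have : w (s j) = σ * (-1) ^ (j : ℕ) := by
          simp only [hwdef, hj, if_true, dif_pos hex, hs.injective hex.choose_spec]
        rw [this]
        exact mul_self_pos.2 (mul_ne_zero hσ (by simp))
      · refine lt_of_le_of_ne ?_ (mul_ne_zero (mul_ne_zero hσ (by simp)) (hw _)).symm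
        have : w (s j) = y (s j) := by simp [hwdef, hj]
        rw [this]
        exact h j
    have : k ≤ signChanges (List.ofFn w) := (le_signChanges_ofFn_iff hk hw).2 ⟨s, hs, σ, hσ, hws⟩
    refine (Nat.cast_le.2 this).trans (le_csSup hbdd ⟨w, hw, fun i hi => by simp [hwdef, hi], rfl⟩)

theorem svb_pred_iff {m n k : ℕ} (hk : 1 ≤ k) (X : Matrix (Fin m) (Fin n) ℝ) :
    SVB X (k - 1) ↔ ∀ u : Fin n → ℝ, u ≠ 0 → ¬ Alternates u k →
      ¬ WeaklyAlternates (X.mulVec u) k := by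
  have key : ∀ v : ℤ, v ≤ ((k - 1 : ℕ) : ℤ) ↔ ¬ (k : ℤ) ≤ v := by
    intro v
    omega
  simp only [SVB, key, le_variation_iff hk, le_maxVariation_iff hk]

theorem forall_of_exchange_of_intervals {k : ℕ} (hk : 1 ≤ k) : ∀ (a n : ℕ) (P : Finset ℕ → Prop),
    (∀ (S : Finset ℕ) (i j p l : ℕ), S.card + 2 = k → S ⊆ Finset.Ico a n → a ≤ i → i < j → j < p →
      p < l → l < n → i ∉ S → j ∉ S → p ∉ S → l ∉ S →
      P (insert i (insert p S)) → P (insert i (insert j S)) → P (insert p (insert l S)) →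
      P (insert i (insert l S)) → P (insert j (insert p S)) → P (insert j (insert l S))) →
    (∀ r t, 1 ≤ r → r ≤ k → a + k - r ≤ t → t + r ≤ n →
      P (Finset.Ico a (a + k - r) ∪ Finset.Ico t (t + r))) →
    ∀ S ⊆ Finset.Ico a n, S.card = k → P S := by
  induction k, hk using Nat.le_induction with
  | base =>
    intro a n P _ hrect S hS hcard
    obtain ⟨x, rfl⟩ := Finset.card_eq_one.1 hcard
    have hx := Finset.mem_Ico.1 (Finset.singleton_subset_iff.1 hS)
    convert hrect 1 x le_rfl le_rfl (by omega) (by omega) using 1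
    ext y
    simp
  | succ k hk ih =>
    intro a n
    induction hd : n - a generalizing a with
    | zero =>
      intro P _ _ S hS hcard
      have := Finset.card_le_card hS
      simp at this
      omega
    | succ d ihd =>
      intro P hexch hrect
      have hmem : ∀ S ⊆ Finset.Ico a n, S.card = k + 1 → a ∈ S → P S := by
        intro S hS hcard haS
        rw [← Finset.insert_erase haS]
        refine ih (a + 1) n (fun T => P (insert a T)) ?_ ?_ (S.erase a) ?_ ?_
        · intro S i j p l hc hS hi hij hjp hpl hl hiS hjS hpS hlS
          have haS : a ∉ S := fun h => by simpa using hS h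
          have := hexch (insert a S) i j p l (by rw [Finset.card_insert_of_notMem haS]; omega)
            (by
              intro x hx
              rcases Finset.mem_insert.1 hx with rfl | hx
              · simp; omega
              · have := Finset.mem_Ico.1 (hS hx)
                simp; omega)
            (by omega) hij hjp hpl hl
            (by simp [hiS]; omega) (by simp [hjS]; omega) (by simp [hpS]; omega)
            (by simp [hlS]; omega)
          simpa only [Finset.insert_comm _ a] using this
        · intro r t hr hrk ht htn
          convert hrect r t hr (by omega) (by omega) htn using 1
          ext y
          simp
          omega
        · intro x hx
          obtain ⟨hxa, hx⟩ := Finset.mem_erase.1 hx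
          have := Finset.mem_Ico.1 (hS hx)
          simp
          omega
        · rw [Finset.card_erase_of_mem haS]
          omega
      have hrect' : ∀ d r t, r + d = k + 1 → 1 ≤ r → a + 1 + (k + 1) - r ≤ t → t + r ≤ n →
          P (Finset.Ico (a + 1) (a + 1 + (k + 1) - r) ∪ Finset.Ico t (t + r)) := by
        intro d
        induction d with
        | zero =>
          intro r t hr hr1 ht htn
          convert hrect r t hr1 (by omega) (by omega) htn using 1
          ext y
          simp
          omega
        | succ d ihd' =>
          intro r t hr hr1 ht
          induction t, ht using Nat.le_induction with
          | base =>
            intro htn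
            convert hrect (k + 1) (a + 1) (by omega) le_rfl (by omega) (by omega) using 1
            ext y
            simp
            omega
          | succ t ht iht =>
            intro htn
            have iht := iht (by omega)
            have hprev := ihd' (r + 1) t (by omega) (by omega) (by omega) (by omega)
            have hS : Finset.Ico (a + 1) (a + 1 + k - r) ∪ Finset.Ico (t + 1) (t + r) ⊆
                Finset.Ico (a + 1) n := by
              intro x
              simp
              omega
            have hdisj : Disjoint (Finset.Ico (a + 1) (a + 1 + k - r))
                (Finset.Ico (t + 1) (t + r)) := by
              rw [Finset.disjoint_left]
              intro x
              simp
              omega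
            have hcard : (Finset.Ico (a + 1) (a + 1 + k - r) ∪
                Finset.Ico (t + 1) (t + r)).card + 1 = k := by
              rw [Finset.card_union_of_disjoint hdisj]
              simp
              omega
            have hsub : ∀ x, a < x → x < n →
                insert x (Finset.Ico (a + 1) (a + 1 + k - r) ∪ Finset.Ico (t + 1) (t + r)) ⊆
                Finset.Ico (a + 1) n :=
              fun x hx hxn => Finset.insert_subset (by simp; omega) hS
            have hins : ∀ x, a < x → x < n →
                x ∉ Finset.Ico (a + 1) (a + 1 + k - r) ∪ Finset.Ico (t + 1) (t + r) →
                P (insert a (insert x (Finset.Ico (a + 1) (a + 1 + k - r) ∪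
                  Finset.Ico (t + 1) (t + r)))) := by
              intro x hx hxn hxS
              refine hmem _ ?_ ?_ (Finset.mem_insert_self _ _)
              · intro y hy
                rcases Finset.mem_insert.1 hy with rfl | hy
                · simp; omega
                · have := Finset.mem_Ico.1 (hsub x hx hxn hy)
                  simp; omega
              · rw [Finset.card_insert_of_notMem, Finset.card_insert_of_notMem hxS, hcard]
                intro h
                simpa using hsub x hx hxn h
            have := hexch (Finset.Ico (a + 1) (a + 1 + k - r) ∪ Finset.Ico (t + 1) (t + r))
              a (a + 1 + k - r) t (t + r) (by omega)
              (hS.trans (Finset.Ico_subset_Ico_left (by omega))) le_rfl (by omega) (by omega)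
              (by omega) (by omega) (by simp; omega) (by simp; omega) (by simp; omega)
              (by simp; omega)
              (hins _ (by omega) (by omega) (by simp; omega))
              (hins _ (by omega) (by omega) (by simp; omega))
              (by
                convert hprev using 1
                ext y
                simp
                omega)
              (hins _ (by omega) (by omega) (by simp; omega))
              (by
                convert iht using 1
                ext y
                simp
                omega)
            convert this using 1
            ext y
            simp
            omega
      intro S hS hcard
      by_cases haS : a ∈ S
      · exact hmem S hS hcard haS
      · refine ihd (a + 1) (by omega) P ?_ ?_ S ?_ hcard
        · intro S i j p l hc hS hi
          exact hexch S i j p l hc (hS.trans (Finset.Ico_subset_Ico_left (by omega))) (by omega)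
        · intro r t hr hrk ht htn
          exact hrect' (k + 1 - r) r t (by omega) hr ht htn
        · intro x hx
          have h1 := Finset.mem_Ico.1 (hS hx)
          have : x ≠ a := fun h => haS (h ▸ hx)
          simp
          omega

theorem det_updateRow_updateRow_self {m : Type*} [Fintype m] [DecidableEq m] (M : Matrix m m ℝ)
    {p q : m} (hpq : p ≠ q) (x : m → ℝ) :
    ((M.updateRow p x).updateRow q (M p)).det = -(M.updateRow q x).det := by
  have : (M.updateRow p x).updateRow q (M p) =
      (M.updateRow q x).submatrix (Equiv.swap p q) id := by
    ext i j
    by_cases hq : i = q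
    · subst hq
      simp [hpq]
    · by_cases hp : i = p
      · subst hp
        simp [hpq]
      · simp [hq, hp, Equiv.swap_apply_of_ne_of_ne hp hq]
  rw [this, Matrix.det_permute, Equiv.Perm.sign_swap hpq]
  simp

theorem det_mul_det_updateRow_updateRow {m : Type*} [Fintype m] [DecidableEq m]
    {M : Matrix m m ℝ} (hM : M.det ≠ 0) {p q : m} (hpq : p ≠ q) (x y : m → ℝ) :
    M.det * ((M.updateRow p x).updateRow q y).det =
      (M.updateRow p x).det * (M.updateRow q y).det -
        (M.updateRow p y).det * (M.updateRow q x).det := by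
  set c := Matrix.vecMul y M⁻¹ with hc
  have hy : y = ∑ i, c i • M i := by
    have h : Matrix.vecMul c M = y := by
      rw [hc, Matrix.vecMul_vecMul, Matrix.nonsing_inv_mul _ (isUnit_iff_ne_zero.2 hM),
        Matrix.vecMul_one]
    rw [← h]
    ext j
    simp [Matrix.vecMul, dotProduct]
  have hcoef : ∀ i, (M.updateRow i y).det = c i * M.det := by
    intro i
    rw [hy, Matrix.det_updateRow_sum, smul_eq_mul]
  have hsplit : y = (∑ i, Function.update c p 0 i • (M.updateRow p x) i) + c p • M p := by
    conv_lhs => rw [hy]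
    rw [← Finset.sum_erase_add _ (fun i => c i • M i) (Finset.mem_univ p),
      ← Finset.sum_erase_add _ (fun i => Function.update c p 0 i • (M.updateRow p x) i)
        (Finset.mem_univ p)]
    congr 1
    simp only [Function.update_self, zero_smul, add_zero]
    refine Finset.sum_congr rfl fun i hi => ?_
    have := Finset.ne_of_mem_erase hi
    rw [Function.update_of_ne this, Matrix.updateRow_ne this]
  have hdet : ((M.updateRow p x).updateRow q y).det =
      c q * (M.updateRow p x).det - c p * (M.updateRow q x).det := by
    conv_lhs => rw [hsplit]
    rw [Matrix.det_updateRow_add, Matrix.det_updateRow_sum, Matrix.det_updateRow_smul,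
      det_updateRow_updateRow_self M hpq, Function.update_of_ne hpq.symm]
    simp only [smul_eq_mul]
    ring
  rw [hdet, hcoef, hcoef]
  ring

/-- The determinant of the rows of `w` selected by `f`, weighted by a Vandermonde determinant so
that it does not depend on the order in which the rows are listed. -/
noncomputable def weightedDet {ι : Type*} {k : ℕ} (φ : ι → ℝ) (w : ι → Fin k → ℝ) (f : Fin k → ι) :
    ℝ :=
  (Matrix.of fun a => w (f a)).det * (Matrix.vandermonde (φ ∘ f)).det

section WeightedDet

variable {ι : Type*} {k m : ℕ} {φ : ι → ℝ}

theorem weightedDet_comp_perm (w : ι → Fin k → ℝ) (f : Fin k → ι) (τ : Equiv.Perm (Fin k)) :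
    weightedDet φ w (f ∘ τ) = weightedDet φ w f := by
  have h1 : (Matrix.of fun a => w ((f ∘ τ) a)) = (Matrix.of fun a => w (f a)).submatrix τ id := rfl
  have h2 : Matrix.vandermonde (φ ∘ f ∘ τ) = (Matrix.vandermonde (φ ∘ f)).submatrix τ id := rfl
  have h3 : ((Equiv.Perm.sign τ : ℤ) : ℝ) * ((Equiv.Perm.sign τ : ℤ) : ℝ) = 1 := by
    rcases Int.units_eq_one_or (Equiv.Perm.sign τ) with h | h <;> simp [h]
  rw [weightedDet, weightedDet, h1, h2, Matrix.det_permute, Matrix.det_permute]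
  linear_combination ((Matrix.of fun a => w (f a)).det * (Matrix.vandermonde (φ ∘ f)).det) * h3

theorem weightedDet_eq_of_range_eq (w : ι → Fin k → ℝ) {f f' : Fin k → ι}
    (hf : f.Injective) (hf' : f'.Injective) (h : Set.range f = Set.range f') :
    weightedDet φ w f = weightedDet φ w f' := by
  set τ : Equiv.Perm (Fin k) := (Equiv.ofInjective f hf).trans
    ((Equiv.setCongr h).trans (Equiv.ofInjective f' hf').symm) with hτ
  have : f = f' ∘ τ := by
    ext i
    simp [hτ, Equiv.apply_ofInjective_symm hf']
  rw [this, weightedDet_comp_perm]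

theorem det_vandermonde_pos {v : Fin k → ℝ} (hv : StrictMono v) :
    0 < (Matrix.vandermonde v).det := by
  rw [Matrix.det_vandermonde]
  exact Finset.prod_pos fun i _ => Finset.prod_pos fun j hj =>
    sub_pos.2 (hv (Finset.mem_Ioi.1 hj))

theorem det_vandermonde_cons (x : ℝ) (v : Fin k → ℝ) :
    (Matrix.vandermonde (Fin.cons x v : Fin (k + 1) → ℝ)).det =
      (∏ a, (v a - x)) * (Matrix.vandermonde v).det := by
  rw [Matrix.det_vandermonde, Matrix.det_vandermonde, Fin.prod_univ_succ, Fin.prod_Ioi_zero]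
  simp [Fin.prod_Ioi_succ]

theorem weightedDet_cons (w : ι → Fin (m + 1) → ℝ) (i : ι) (g : Fin m → ι) :
    weightedDet φ w (Fin.cons i g) =
      (Matrix.of fun a => w ((Fin.cons i g : Fin (m + 1) → ι) a)).det * ((∏ a, (φ (g a) - φ i)) *
        (Matrix.vandermonde (φ ∘ g)).det) := by
  have : φ ∘ (Fin.cons i g : Fin (m + 1) → ι) = Fin.cons (φ i) (φ ∘ g) := by
    ext a
    refine Fin.cases ?_ (fun a => ?_) a <;> simp
  rw [weightedDet, this, det_vandermonde_cons]
  rfl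

theorem weightedDet_cons_cons (w : ι → Fin (m + 2) → ℝ) (i j : ι) (g : Fin m → ι) :
    weightedDet φ w (Fin.cons i (Fin.cons j g : Fin (m + 1) → ι)) =
      (φ j - φ i) *
        ((Matrix.of fun a => w ((Fin.cons i (Fin.cons j g : Fin (m + 1) → ι) :
          Fin (m + 2) → ι) a)).det * (∏ a, (φ (g a) - φ i)) * (∏ a, (φ (g a) - φ j)) *
            (Matrix.vandermonde (φ ∘ g)).det) := by
  have : φ ∘ (Fin.cons j g : Fin (m + 1) → ι) = Fin.cons (φ j) (φ ∘ g) := by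
    ext a
    refine Fin.cases ?_ (fun a => ?_) a <;> simp
  rw [weightedDet_cons, this, det_vandermonde_cons, Fin.prod_univ_succ]
  simp only [Fin.cons_zero, Fin.cons_succ, Function.comp]
  ring

theorem weightedDet_exchange (w : ι → Fin (m + 2) → ℝ) (g : Fin m → ι) {i j p l : ι} {ε : ℝ}
    (hij : φ i < φ j) (hjp : φ j < φ p) (hpl : φ p < φ l)
    (h_ip : 0 < ε * weightedDet φ w (Fin.cons i (Fin.cons p g : Fin (m + 1) → ι)))
    (h_ij : 0 < ε * weightedDet φ w (Fin.cons i (Fin.cons j g : Fin (m + 1) → ι)))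
    (h_pl : 0 < ε * weightedDet φ w (Fin.cons p (Fin.cons l g : Fin (m + 1) → ι)))
    (h_il : 0 < ε * weightedDet φ w (Fin.cons i (Fin.cons l g : Fin (m + 1) → ι)))
    (h_jp : 0 < ε * weightedDet φ w (Fin.cons j (Fin.cons p g : Fin (m + 1) → ι))) :
    0 < ε * weightedDet φ w (Fin.cons j (Fin.cons l g : Fin (m + 1) → ι)) := by
  set D : ι → ι → ℝ := fun x y => (Matrix.of fun a => w ((Fin.cons x (Fin.cons y g :
    Fin (m + 1) → ι) : Fin (m + 2) → ι) a)).det with hD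
  set q : ι → ℝ := fun x => ∏ a, (φ (g a) - φ x) with hq
  set V := (Matrix.vandermonde (φ ∘ g)).det with hV
  have key : ∀ x y, φ x < φ y →
      (0 < ε * weightedDet φ w (Fin.cons x (Fin.cons y g : Fin (m + 1) → ι)) ↔
        0 < ε * (D x y * q x * q y * V)) := by
    intro x y hxy
    rw [weightedDet_cons_cons, mul_left_comm, mul_pos_iff_of_pos_left (sub_pos.2 hxy)]
  rw [key i p (hij.trans hjp)] at h_ip
  rw [key i j hij] at h_ij
  rw [key p l hpl] at h_pl
  rw [key i l (hij.trans (hjp.trans hpl))] at h_il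
  rw [key j p hjp] at h_jp
  rw [key j l (hjp.trans hpl)]
  have hDip : D i p ≠ 0 := by
    intro h
    simp [h] at h_ip
  have hupd : ∀ x y z,
      ((Matrix.of fun a => w ((Fin.cons x (Fin.cons y g : Fin (m + 1) → ι) : Fin (m + 2) → ι) a)
        ).updateRow 0 (w z)) = Matrix.of fun a => w ((Fin.cons z (Fin.cons y g :
          Fin (m + 1) → ι) : Fin (m + 2) → ι) a) := by
    intro x y z
    ext a b
    refine Fin.cases ?_ (fun a => ?_) a
    · simp
    · simp
  have hupd' : ∀ x y z,
      ((Matrix.of fun a => w ((Fin.cons x (Fin.cons y g : Fin (m + 1) → ι) : Fin (m + 2) → ι) a)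
        ).updateRow 1 (w z)) = Matrix.of fun a => w ((Fin.cons x (Fin.cons z g :
          Fin (m + 1) → ι) : Fin (m + 2) → ι) a) := by
    intro x y z
    ext a b
    refine Fin.cases ?_ (fun a => Fin.cases ?_ (fun a => ?_) a) a
    · rw [Matrix.updateRow_ne (by simp)]
      simp
    · simp
    · rw [Matrix.updateRow_ne]
      · simp
      · simp [Fin.ext_iff]
  have hpl' : D i p * D j l = D j p * D i l + D p l * D i j := by
    have h := det_mul_det_updateRow_updateRow hDip (p := 0) (q := 1) (by simp) (w j) (w l)
    have hanti : D l p = -D p l := by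
      have := det_updateRow_updateRow_self (Matrix.of fun a => w ((Fin.cons p (Fin.cons p g :
        Fin (m + 1) → ι) : Fin (m + 2) → ι) a)) (p := 0) (q := 1) (by simp) (w l)
      have hrow : (Matrix.of fun a => w ((Fin.cons p (Fin.cons p g : Fin (m + 1) → ι) :
          Fin (m + 2) → ι) a)) 0 = w p := rfl
      rw [hrow, hupd, hupd', hupd'] at this
      exact this
    simp only [hupd, hupd'] at h
    change D i p * D j l = D j p * D i l - D l p * D i j at h
    rw [h, hanti]
    ring
  have hprod : (ε * (D i p * q i * q p * V)) * (ε * (D j l * q j * q l * V)) =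
      (ε * (D j p * q j * q p * V)) * (ε * (D i l * q i * q l * V)) +
        (ε * (D p l * q p * q l * V)) * (ε * (D i j * q i * q j * V)) := by
    linear_combination (ε ^ 2 * q i * q j * q p * q l * V ^ 2) * hpl'
  refine pos_of_mul_pos_right ?_ h_ip.le
  rw [hprod]
  positivity

end WeightedDet

theorem mul_weightedDet_pos_iff {ι : Type*} [Preorder ι] {k : ℕ} {φ : ι → ℝ} (hφ : StrictMono φ)
    (w : ι → Fin k → ℝ) {f : Fin k → ι} (hf : StrictMono f) (ε : ℝ) :
    0 < ε * weightedDet φ w f ↔ 0 < ε * (Matrix.of fun a => w (f a)).det := by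
  rw [weightedDet, ← mul_assoc, mul_pos_iff_of_pos_right (det_vandermonde_pos (hφ.comp hf))]

theorem mul_det_pos_of_intervals {k n : ℕ} (hk : 1 ≤ k) (w : ℕ → Fin k → ℝ) (ε : ℝ)
    (h : ∀ r t, 1 ≤ r → r ≤ k → k - r ≤ t → t + r ≤ n →
      0 < ε * (Matrix.of fun a : Fin k =>
        w (if (a : ℕ) < k - r then (a : ℕ) else (a : ℕ) - (k - r) + t)).det)
    (f : Fin k → ℕ) (hf : StrictMono f) (hfn : ∀ a, f a < n) :
    0 < ε * (Matrix.of fun a => w (f a)).det := by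
  set φ : ℕ → ℝ := fun i => (i : ℝ) with hφdef
  have hφ : StrictMono φ := Nat.strictMono_cast
  set P : Finset ℕ → Prop := fun T => ∀ f : Fin k → ℕ, f.Injective → Set.range f = ↑T →
    0 < ε * weightedDet φ w f with hPdef
  have hP : ∀ (f : Fin k → ℕ) (T : Finset ℕ), f.Injective → Set.range f = ↑T →
      (P T ↔ 0 < ε * weightedDet φ w f) := by
    intro f T hf hT
    refine ⟨fun h => h f hf hT, fun h f' hf' hT' => ?_⟩
    rwa [weightedDet_eq_of_range_eq w hf' hf (hT'.trans hT.symm)]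
  rw [← mul_weightedDet_pos_iff hφ w hf]
  refine forall_of_exchange_of_intervals hk 0 n P ?_ ?_ (Finset.univ.image f) ?_ ?_ f
    hf.injective (by simp)
  · intro S i j p l hc _ _ hij hjp hpl _ hi hj hp hl
    obtain ⟨m, rfl⟩ : ∃ m, k = m + 2 := ⟨S.card, hc.symm⟩
    have hS : S.card = m := by omega
    set g : Fin m → ℕ := ⇑(S.orderEmbOfFin hS) with hg
    have hcons : ∀ x y, x ∉ S → y ∉ S → x ≠ y → (P (insert x (insert y S)) ↔
        0 < ε * weightedDet φ w (Fin.cons x (Fin.cons y g : Fin (m + 1) → ℕ))) := by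
      intro x y hx hy hxy
      apply hP
      · rw [Fin.cons_injective_iff, Fin.cons_injective_iff, Fin.range_cons, hg,
          Finset.range_orderEmbOfFin]
        exact ⟨by simp [hx, hxy], by simpa using hy, (S.orderEmbOfFin hS).injective⟩
      · rw [Fin.range_cons, Fin.range_cons, hg, Finset.range_orderEmbOfFin]
        simp
    rw [hcons i p hi hp (by omega), hcons i j hi hj (by omega), hcons p l hp hl (by omega),
      hcons i l hi hl (by omega), hcons j p hj hp (by omega), hcons j l hj hl (by omega)]
    exact weightedDet_exchange w g (hφ hij) (hφ hjp) (hφ hpl)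
  · intro r t hr hrk ht htn
    have hmono : StrictMono fun a : Fin k =>
        if (a : ℕ) < k - r then (a : ℕ) else (a : ℕ) - (k - r) + t := by
      intro a b hab
      have : (a : ℕ) < b := hab
      dsimp only
      split_ifs <;> omega
    refine (hP _ _ hmono.injective ?_).2 ((mul_weightedDet_pos_iff hφ w hmono ε).2
      (h r t hr hrk (by omega) htn))
    ext x
    simp only [Set.mem_range, Finset.coe_union, Finset.coe_Ico, Set.mem_union, Set.mem_Ico]
    constructor
    · rintro ⟨a, rfl⟩
      split_ifs <;> omega
    · intro hx
      by_cases hxk : x < k - r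
      · exact ⟨⟨x, by omega⟩, by simp [hxk]⟩
      · refine ⟨⟨x - t + (k - r), by omega⟩, ?_⟩
        dsimp only
        split_ifs <;> omega
  · intro x hx
    obtain ⟨a, -, rfl⟩ := Finset.mem_image.1 hx
    simpa using hfn a
  · rw [Finset.card_image_of_injective _ hf.injective, Finset.card_fin]

theorem exists_surjective_monotone {n k : ℕ} (hk : 1 ≤ k) (hkn : k ≤ n) (u : Fin n → ℝ)
    (hu : ¬ Alternates u k) :
    ∃ p : Fin n → Fin k, Monotone p ∧ p.Surjective ∧ ∀ i j, p i = p j → 0 ≤ u i * u j := by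
  classical
  have hex : ∃ q, k ≤ q ∧ ∃ p : Fin n → Fin q, Monotone p ∧ p.Surjective ∧
      ∀ i j, p i = p j → 0 ≤ u i * u j :=
    ⟨n, hkn, id, monotone_id, Function.surjective_id, fun i j h => by
      rw [show i = j from h]; exact mul_self_nonneg _⟩
  obtain ⟨hkq, p, hmono, hsurj, hsign⟩ := Nat.find_spec hex
  have hmin := fun q => Nat.find_min hex (m := q)
  generalize Nat.find hex = q at *
  rcases hkq.eq_or_lt with rfl | hlt
  · exact ⟨p, hmono, hsurj, hsign⟩
  exfalso
  obtain ⟨q, rfl⟩ : ∃ q', q = q' + 1 := ⟨q - 1, by omega⟩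
  have hpair : ∀ j : Fin q, ∃ a b, p a = j.castSucc ∧ p b = j.succ ∧ u a * u b < 0 := by
    intro j
    by_contra! hcon
    refine hmin q (by omega) ⟨by omega, ⟨fun i => j.predAbove (p i),
      (Fin.predAbove_right_monotone j).comp hmono,
      (Fin.predAbove_surjective j).comp hsurj, ?_⟩⟩
    intro a b hab
    by_cases h : p a = p b
    · exact hsign a b h
    have hcases : (p a = j.castSucc ∧ p b = j.succ) ∨ (p b = j.castSucc ∧ p a = j.succ) := by
      simp only [Fin.predAbove] at hab
      split_ifs at hab with h1 h2 h2 <;>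
        simp only [Fin.lt_def, Fin.ext_iff, Fin.val_pred, Fin.coe_castPred, Fin.val_castSucc,
          Fin.val_succ] at hab h h1 h2 ⊢ <;> omega
    rcases hcases with ⟨ha, hb⟩ | ⟨hb, ha⟩
    · exact hcon a b ha hb
    · rw [mul_comm]
      exact hcon b a hb ha
  choose a b ha hb hab using hpair
  have hq : 1 ≤ q := by omega
  have hc : ∀ j : Fin (q + 1), ∃ c, p c = j ∧ u c ≠ 0 := by
    intro j
    induction j using Fin.cases with
    | zero =>
      exact ⟨a ⟨0, hq⟩, ha _, left_ne_zero_of_mul (hab _).ne⟩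
    | succ j => exact ⟨b j, hb j, right_ne_zero_of_mul (hab _).ne⟩
  choose c hc hcne using hc
  have hcmono : StrictMono c := by
    intro i j hij
    by_contra h
    have := hmono (not_lt.1 h)
    rw [hc, hc] at this
    exact absurd hij this.not_gt
  have hneg : ∀ j : Fin q, u (c j.castSucc) * u (c j.succ) < 0 := by
    intro j
    have h1 := hsign (c j.castSucc) (a j) (by rw [hc, ha])
    have h2 := hsign (c j.succ) (b j) (by rw [hc, hb])
    have h1' : 0 < u (c j.castSucc) * u (a j) := lt_of_le_of_ne h1
      (mul_ne_zero (hcne _) (left_ne_zero_of_mul (hab j).ne)).symm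
    have h2' : 0 < u (c j.succ) * u (b j) := lt_of_le_of_ne h2
      (mul_ne_zero (hcne _) (right_ne_zero_of_mul (hab j).ne)).symm
    have h3 := mul_pos (mul_pos h1' h2') (neg_pos.2 (hab j))
    have h4 : 0 ≤ (u (a j) * u (b j)) ^ 2 := sq_nonneg _
    by_contra h5
    nlinarith [mul_nonneg h4 (not_lt.1 h5)]
  refine hu ((alternates_iff_consecutive u hk).2 ⟨fun j => c (Fin.castLE (by omega) j), ?_, ?_⟩)
  · exact hcmono.comp (Fin.strictMono_castLE _)
  · intro j
    exact hneg (Fin.castLE (by omega) j)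

theorem exists_nonneg_factorization {n k : ℕ} {u : Fin n → ℝ} {p : Fin n → Fin k}
    (hsurj : p.Surjective) (hsign : ∀ i j, p i = p j → 0 ≤ u i * u j) :
    ∃ (d : Fin k → ℝ) (e : Fin n → ℝ), (∀ i, 0 ≤ e i) ∧ (∀ j, ∃ i, p i = j ∧ 0 < e i) ∧
      ∀ i, u i = d (p i) * e i := by
  have : ∀ j, ∃ (d : ℝ) (e : Fin n → ℝ), (∀ i, p i = j → 0 ≤ e i) ∧ (∃ i, p i = j ∧ 0 < e i) ∧
      ∀ i, p i = j → u i = d * e i := by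
    intro j
    by_cases h : ∃ i, p i = j ∧ u i ≠ 0
    · obtain ⟨i, hi, hui⟩ := h
      refine ⟨u i, fun l => u l / u i, fun l hl => ?_, ⟨i, hi, by simp [hui]⟩,
        fun l _ => by field_simp⟩
      have := hsign l i (hl.trans hi.symm)
      change 0 ≤ u l / u i
      rw [show u l / u i = u l * u i / (u i) ^ 2 by field_simp]
      positivity
    · push Not at h
      obtain ⟨i, hi⟩ := hsurj j
      exact ⟨0, fun _ => 1, fun _ _ => zero_le_one, ⟨i, hi, one_pos⟩, fun l hl => by simp [h l hl]⟩
  choose d e h1 h2 h3 using this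
  refine ⟨d, fun i => e (p i) i, fun i => h1 _ i rfl, fun j => ?_, fun i => h3 _ i rfl⟩
  obtain ⟨i, hi, hpos⟩ := h2 j
  exact ⟨i, hi, by simpa only [hi] using hpos⟩

theorem det_mul_eq_sum {n k : ℕ} (B : Matrix (Fin k) (Fin n) ℝ) (G : Matrix (Fin n) (Fin k) ℝ) :
    (B * G).det = ∑ h : Fin k → Fin n, (∏ j, G (h j) j) * (B.submatrix id h).det := by
  rw [← Matrix.det_transpose]
  have : (B * G)ᵀ = fun j => ∑ i, G i j • Bᵀ i := by
    ext j a
    simp [Matrix.mul_apply, mul_comm]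
  rw [this]
  change Matrix.detRowAlternating.toMultilinearMap _ = _
  rw [MultilinearMap.map_sum]
  refine Finset.sum_congr rfl fun h _ => ?_
  rw [MultilinearMap.map_smul_univ, smul_eq_mul]
  congr 1
  rw [← Matrix.det_transpose (B.submatrix id h)]
  rfl

theorem not_weaklyAlternates_of_minors_pos {N n k : ℕ} (hk : 1 ≤ k) (hkn : k ≤ n)
    (X : Matrix (Fin N) (Fin n) ℝ) {ε : ℝ}
    (hX : ∀ (f : Fin k → Fin N) (g : Fin k → Fin n), StrictMono f → StrictMono g →
      0 < ε * (X.submatrix f g).det) (u : Fin n → ℝ) (hu : u ≠ 0) (hua : ¬ Alternates u k) :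
    ¬ WeaklyAlternates (X.mulVec u) k := by
  classical
  rintro ⟨s, hs, σ, hσ, hσs⟩
  obtain ⟨p, hmono, hsurj, hsign⟩ := exists_surjective_monotone hk hkn u hua
  obtain ⟨d, e, he, hepos, hude⟩ := exists_nonneg_factorization hsurj hsign
  set G : Matrix (Fin n) (Fin k) ℝ := Matrix.of fun i j => if p i = j then e i else 0 with hG
  have hGd : G.mulVec d = u := by
    ext i
    simp [hG, Matrix.mulVec, dotProduct, hude, mul_comm]
  have hd : d ≠ 0 := by
    rintro rfl
    exact hu (by rw [← hGd, Matrix.mulVec_zero])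
  have hG0 : ∀ i j, 0 ≤ G i j := by
    intro i j
    simp only [hG, Matrix.of_apply]
    split_ifs
    exacts [he i, le_rfl]
  have hY : ∀ f : Fin k → Fin N, StrictMono f → 0 < ε * ((X * G).submatrix f id).det := by
    intro f hf
    have hsub : (X * G).submatrix f id = X.submatrix f id * G := by
      ext i j
      simp [Matrix.mul_apply]
    rw [hsub, det_mul_eq_sum, Finset.mul_sum]
    have hterm : ∀ h : Fin k → Fin n, (∏ j, G (h j) j) ≠ 0 →
        0 < ε * ((∏ j, G (h j) j) * ((X.submatrix f id).submatrix id h).det) := by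
      intro h hne
      have hh : StrictMono h := by
        have hph : ∀ j, p (h j) = j := by
          intro j
          have := Finset.prod_ne_zero_iff.1 hne j (Finset.mem_univ _)
          by_contra hcon
          simp [hG, hcon] at this
        intro i j hij
        by_contra hcon
        have := hmono (not_lt.1 hcon)
        rw [hph, hph] at this
        exact absurd hij this.not_gt
      rw [mul_left_comm]
      exact mul_pos (lt_of_le_of_ne (Finset.prod_nonneg fun _ _ => hG0 _ _) hne.symm)
        (hX f h hf hh)
    choose h0 hp0 he0 using hepos
    refine Finset.sum_pos' (fun h _ => ?_) ⟨h0, Finset.mem_univ _, hterm h0 ?_⟩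
    · by_cases hne : (∏ j, G (h j) j) = 0
      · simp [hne]
      · exact (hterm h hne).le
    · refine Finset.prod_ne_zero_iff.2 fun j _ => ?_
      simp [hG, hp0, (he0 j).ne']
  have hyY : X.mulVec u = (X * G).mulVec d := by
    rw [← Matrix.mulVec_mulVec, hGd]
  rw [hyY] at hσs
  set Y := X * G with hYdef
  set M : Matrix (Fin (k + 1)) (Fin (k + 1)) ℝ :=
    Matrix.of fun i => Fin.cons (Y.mulVec d (s i)) (Y (s i)) with hM
  have hM0 : M.det = 0 := by
    rw [← Matrix.exists_mulVec_eq_zero_iff]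
    refine ⟨Fin.cons (-1) d, fun h => by simpa using congrFun h 0, ?_⟩
    ext i
    simp [hM, Matrix.mulVec, dotProduct, Fin.sum_univ_succ]
  have hsucc : ∀ i : Fin (k + 1),
      0 < ε * (Y.submatrix (fun a : Fin k => s (i.succAbove a)) id).det := fun i =>
    hY _ (hs.comp (Fin.strictMono_succAbove i))
  have hsum : ∑ i : Fin (k + 1), (σ * (-1) ^ (i : ℕ) * Y.mulVec d (s i)) *
      (ε * (Y.submatrix (fun a : Fin k => s (i.succAbove a)) id).det) = 0 := by
    have := Matrix.det_succ_column_zero M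
    rw [hM0] at this
    calc _ = σ * ε * ∑ i : Fin (k + 1), (-1) ^ (i : ℕ) * M i 0 *
          (M.submatrix i.succAbove Fin.succ).det := by
            rw [Finset.mul_sum]
            refine Finset.sum_congr rfl fun i _ => ?_
            have h1 : M i 0 = Y.mulVec d (s i) := by simp [hM]
            have h2 : M.submatrix i.succAbove Fin.succ =
                Y.submatrix (fun a : Fin k => s (i.succAbove a)) id := by
              ext a b
              simp [hM]
            rw [h1, h2]
            ring
      _ = 0 := by rw [← this, mul_zero]
  have hzero : ∀ i, Y.mulVec d (s i) = 0 := by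
    intro i
    have := (Finset.sum_eq_zero_iff_of_nonneg fun i _ =>
      mul_nonneg (hσs i) (hsucc i).le).1 hsum i (Finset.mem_univ _)
    rcases mul_eq_zero.1 this with h | h
    · exact (mul_eq_zero.1 h).resolve_left (mul_ne_zero hσ (by simp))
    · exact absurd h (hsucc i).ne'
  have hdet := hsucc 0
  rw [Matrix.exists_mulVec_eq_zero_iff.1 ⟨d, hd, by
    ext a
    exact hzero _⟩, mul_zero] at hdet
  exact lt_irrefl _ hdet

theorem prod_sub_mul_sub_sign {ι : Type*} [Preorder ι] {m : ℕ} {φ : ι → ℝ} (hφ : StrictMono φ)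
    {e : Fin m → ι} (he : StrictMono e) {a b : Fin m} (hab : a < b) :
    0 < (-1) ^ ((a : ℕ) + b + 1) *
      ∏ x ∈ Finset.univ \ {a, b}, (φ (e x) - φ (e a)) * (φ (e x) - φ (e b)) := by
  have hφe : StrictMono (φ ∘ e) := hφ.comp he
  have hpos : 0 < ∏ x ∈ Finset.univ \ {a, b}, (if x ∈ Finset.Ioo a b then (-1 : ℝ) else 1) *
      ((φ (e x) - φ (e a)) * (φ (e x) - φ (e b))) := by
    refine Finset.prod_pos fun x hx => ?_
    simp only [Finset.mem_sdiff, Finset.mem_univ, Finset.mem_insert, Finset.mem_singleton, true_and,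
      not_or] at hx
    rcases lt_or_gt_of_ne hx.1 with hxa | hax
    · have h1 := hφe hxa
      have h2 := hφe (hxa.trans hab)
      rw [if_neg (by simp [hxa.not_gt]), one_mul]
      exact mul_pos_of_neg_of_neg (sub_neg.2 h1) (sub_neg.2 h2)
    · have h1 := hφe hax
      rcases lt_or_gt_of_ne hx.2 with hxb | hbx
      · rw [if_pos (by simp [hax, hxb]), neg_one_mul, neg_pos]
        exact mul_neg_of_pos_of_neg (sub_pos.2 h1) (sub_neg.2 (hφe hxb))
      · rw [if_neg (by simp [hbx.not_gt]), one_mul]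
        exact mul_pos (sub_pos.2 h1) (sub_pos.2 (hφe hbx))
  have hfilter : (Finset.univ \ {a, b}).filter (· ∈ Finset.Ioo a b) = Finset.Ioo a b := by
    ext x
    simp only [Finset.mem_filter, Finset.mem_sdiff, Finset.mem_univ, Finset.mem_insert,
      Finset.mem_singleton, true_and, Finset.mem_Ioo, not_or, and_iff_right_iff_imp]
    exact fun h => ⟨h.1.ne', h.2.ne⟩
  rw [Finset.prod_mul_distrib, ← Finset.prod_filter, hfilter, Finset.prod_const, Fin.card_Ioo]
    at hpos
  have hexp : (a : ℕ) + b + 1 = ((b : ℕ) - a - 1) + 2 * ((a : ℕ) + 1) := by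
    have : (a : ℕ) < b := hab
    omega
  rwa [hexp, pow_add, pow_mul, neg_one_sq, one_pow, mul_one]

section Transposition

variable {ι : Type*} [LinearOrder ι] {m : ℕ} {φ : ι → ℝ} {i j : ι} {g : Fin m → ι}

theorem exists_enumeration_of_lt (hφ : StrictMono φ) (hg : g.Injective) (hi : i ∉ Set.range g)
    (hj : j ∉ Set.range g) (hij : i < j) :
    ∃ (e : Fin (m + 2) → ι) (a b : Fin (m + 2)), StrictMono e ∧ e a = i ∧ e b = j ∧
      (∀ x, x ≠ a → x ≠ b → e x ∈ Set.range g) ∧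
      (∀ s : Fin (m + 2) → ι, StrictMono s →
        (∀ x, s x = i ∨ s x = j ∨ s x ∈ Set.range g) → s = e) ∧
      0 < (-1) ^ ((a : ℕ) + b + 1) * ∏ x, (φ (g x) - φ i) * (φ (g x) - φ j) := by
  classical
  set T : Finset ι := insert i (insert j (Finset.univ.image g)) with hT
  have hmem : ∀ y, y ∈ T ↔ y = i ∨ y = j ∨ y ∈ Set.range g := by
    intro y
    simp [hT]
  have hcard : T.card = m + 2 := by
    rw [hT, Finset.card_insert_of_notMem, Finset.card_insert_of_notMem,
      Finset.card_image_of_injective _ hg]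
    · simp
    · simpa using hj
    · simpa [hij.ne] using hi
  set e := T.orderEmbOfFin hcard with he
  have hsurj : ∀ y ∈ T, ∃ x, e x = y := by
    intro y hy
    have : y ∈ Set.range e := by rw [he, Finset.range_orderEmbOfFin]; exact hy
    exact this
  obtain ⟨a, ha⟩ := hsurj i ((hmem i).2 (Or.inl rfl))
  obtain ⟨b, hb⟩ := hsurj j ((hmem j).2 (Or.inr (Or.inl rfl)))
  have hab : a < b := by
    rw [← e.lt_iff_lt, ha, hb]
    exact hij
  have hrest : ∀ x, x ≠ a → x ≠ b → e x ∈ Set.range g := by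
    intro x hxa hxb
    rcases (hmem _).1 (Finset.orderEmbOfFin_mem T hcard x) with h | h | h
    · exact absurd (e.injective (h.trans ha.symm)) hxa
    · exact absurd (e.injective (h.trans hb.symm)) hxb
    · exact h
  refine ⟨e, a, b, e.strictMono, ha, hb, hrest, fun s hs hsT =>
    Finset.orderEmbOfFin_unique hcard (fun x => (hmem _).2 (hsT x)) hs, ?_⟩
  have himage : Finset.univ.image g = (Finset.univ \ {a, b}).image e := by
    ext y
    simp only [Finset.mem_image, Finset.mem_univ, true_and, Finset.mem_sdiff, Finset.mem_insert,
      Finset.mem_singleton, not_or]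
    constructor
    · rintro ⟨x, rfl⟩
      obtain ⟨z, hz⟩ := hsurj (g x) ((hmem _).2 (Or.inr (Or.inr ⟨x, rfl⟩)))
      refine ⟨z, ⟨?_, ?_⟩, hz⟩
      · rintro rfl
        exact hi ⟨x, hz.symm.trans ha⟩
      · rintro rfl
        exact hj ⟨x, hz.symm.trans hb⟩
    · rintro ⟨x, ⟨hxa, hxb⟩, rfl⟩
      exact hrest x hxa hxb
  have hprod : ∏ x, (φ (g x) - φ i) * (φ (g x) - φ j) =
      ∏ x ∈ Finset.univ \ {a, b}, (φ (e x) - φ (e a)) * (φ (e x) - φ (e b)) := by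
    rw [ha, hb, ← Finset.prod_image (f := fun y => (φ y - φ i) * (φ y - φ j))
      e.injective.injOn, ← himage, Finset.prod_image hg.injOn]
  rw [hprod]
  exact prod_sub_mul_sub_sign hφ e.strictMono hab

theorem weaklyAlternates_of_prod_nonpos (hφ : StrictMono φ) (hg : g.Injective)
    (hi : i ∉ Set.range g) (hj : j ∉ Set.range g) (hij : i ≠ j) {y : ι → ℝ}
    (hy0 : ∀ x, y (g x) = 0)
    (hy : y i * y j * ∏ x, (φ (g x) - φ i) * (φ (g x) - φ j) ≤ 0) :
    WeaklyAlternates y (m + 1) := by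
  wlog h : i < j generalizing i j
  · refine this hj hi hij.symm ?_ (lt_of_le_of_ne (not_lt.1 h) hij.symm)
    simpa only [mul_comm] using hy
  obtain ⟨e, a, b, he, ha, hb, hrest, -, hsign⟩ := exists_enumeration_of_lt hφ hg hi hj h
  have hpq : 0 ≤ ((-1) ^ (a : ℕ) * y i) * ((-1) ^ (b : ℕ) * y j) := by
    by_contra hcon
    have h2 := mul_neg_of_neg_of_pos (not_le.1 hcon) hsign
    have h3 : ((-1 : ℝ) ^ (a : ℕ)) ^ 2 = 1 := by rw [← pow_mul, mul_comm, pow_mul]; simp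
    have h4 : ((-1 : ℝ) ^ (b : ℕ)) ^ 2 = 1 := by rw [← pow_mul, mul_comm, pow_mul]; simp
    rw [pow_succ, pow_add] at h2
    have h5 : ((-1) ^ (a : ℕ) * y i) * ((-1) ^ (b : ℕ) * y j) *
        ((-1) ^ (a : ℕ) * (-1) ^ (b : ℕ) * -1 * ∏ x, (φ (g x) - φ i) * (φ (g x) - φ j)) =
        -(((-1 : ℝ) ^ (a : ℕ)) ^ 2 * ((-1 : ℝ) ^ (b : ℕ)) ^ 2 *
          (y i * y j * ∏ x, (φ (g x) - φ i) * (φ (g x) - φ j))) := by ring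
    rw [h5, h3, h4] at h2
    linarith
  obtain ⟨σ, hσ, h1, h2⟩ : ∃ σ : ℝ, σ ≠ 0 ∧ 0 ≤ σ * ((-1) ^ (a : ℕ) * y i) ∧
      0 ≤ σ * ((-1) ^ (b : ℕ) * y j) := by
    rcases mul_nonneg_iff.1 hpq with ⟨h1, h2⟩ | ⟨h1, h2⟩
    · exact ⟨1, one_ne_zero, by linarith, by linarith⟩
    · exact ⟨-1, by norm_num, by linarith, by linarith⟩
  refine ⟨e, he, σ, hσ, fun x => ?_⟩
  by_cases hxa : x = a
  · rw [hxa, ha, mul_assoc]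
    exact h1
  by_cases hxb : x = b
  · rw [hxb, hb, mul_assoc]
    exact h2
  obtain ⟨z, hz⟩ := hrest x hxa hxb
  rw [← hz, hy0, mul_zero]

theorem not_alternates_of_prod_nonneg (hφ : StrictMono φ) (hg : g.Injective)
    (hi : i ∉ Set.range g) (hj : j ∉ Set.range g) (hij : i ≠ j) {u : ι → ℝ}
    (hu0 : ∀ x, u x ≠ 0 → x = i ∨ x = j ∨ x ∈ Set.range g)
    (hu : 0 ≤ u i * u j * ∏ x, (φ (g x) - φ i) * (φ (g x) - φ j)) :
    ¬ Alternates u (m + 1) := by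
  wlog h : i < j generalizing i j
  · refine this hj hi hij.symm (fun x hx => ?_) ?_ (lt_of_le_of_ne (not_lt.1 h) hij.symm)
    · have := hu0 x hx
      tauto
    · simpa only [mul_comm] using hu
  obtain ⟨e, a, b, -, ha, hb, -, huniq, hsign⟩ := exists_enumeration_of_lt hφ hg hi hj h
  rintro ⟨s, hs, σ, hσ, hσs⟩
  obtain rfl := huniq s hs fun x => hu0 _ (right_ne_zero_of_mul (hσs x).ne')
  have h1 := hσs a
  have h2 := hσs b
  rw [ha] at h1
  rw [hb] at h2
  have h3 := mul_pos (mul_pos h1 h2) hsign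
  have h4 : ((-1 : ℝ) ^ (a : ℕ)) ^ 2 = 1 := by rw [← pow_mul, mul_comm, pow_mul]; simp
  have h5 : ((-1 : ℝ) ^ (b : ℕ)) ^ 2 = 1 := by rw [← pow_mul, mul_comm, pow_mul]; simp
  rw [pow_succ, pow_add] at h3
  have h6 : σ * (-1) ^ (a : ℕ) * u i * (σ * (-1) ^ (b : ℕ) * u j) *
      ((-1) ^ (a : ℕ) * (-1) ^ (b : ℕ) * -1 * ∏ x, (φ (g x) - φ i) * (φ (g x) - φ j)) =
      -(((-1 : ℝ) ^ (a : ℕ)) ^ 2 * ((-1 : ℝ) ^ (b : ℕ)) ^ 2 *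
        (σ ^ 2 * (u i * u j * ∏ x, (φ (g x) - φ i) * (φ (g x) - φ j)))) := by ring
  rw [h6, h4, h5] at h3
  have := mul_nonneg (sq_nonneg σ) hu
  linarith

theorem weaklyAlternates_of_zero [Infinite ι] (hφ : StrictMono φ) {f : Fin (m + 1) → ι}
    (hf : f.Injective) {y : ι → ℝ} (hy : ∀ x, y (f x) = 0) : WeaklyAlternates y (m + 1) := by
  obtain ⟨j, hj⟩ := (Set.finite_range f).exists_notMem
  refine weaklyAlternates_of_prod_nonpos (i := f 0) (j := j) (g := f ∘ Fin.succ) hφ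
    (hf.comp (Fin.succ_injective _)) ?_ ?_ ?_ (fun x => hy _) (by simp [hy])
  · rintro ⟨x, hx⟩
    exact Fin.succ_ne_zero x (hf hx)
  · rintro ⟨x, hx⟩
    exact hj ⟨_, hx⟩
  · rintro rfl
    exact hj ⟨0, rfl⟩

theorem not_alternates_of_support {g : Fin m → ι} {u : ι → ℝ}
    (hu : ∀ x, u x ≠ 0 → x ∈ Set.range g) : ¬ Alternates u m := by
  rintro ⟨s, hs, σ, -, hσs⟩
  choose t ht using fun x => hu (s x) (right_ne_zero_of_mul (hσs x).ne')
  have : t.Injective := fun a b hab => hs.injective (by rw [← ht, ← ht, hab])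
  simpa using Fintype.card_le_of_injective t this

theorem of_cons_swap {α : Type*} {R : (Fin (m + 1) → α) → Prop}
    (hR : ∀ f f' : Fin (m + 1) → α, f.Injective → f'.Injective → Set.range f = Set.range f' →
      R f → R f')
    (hswap : ∀ (g : Fin m → α) (i j : α), g.Injective → i ∉ Set.range g → j ∉ Set.range g →
      i ≠ j → R (Fin.cons i g) → R (Fin.cons j g))
    {f f' : Fin (m + 1) → α} (hf : f.Injective) (hf' : f'.Injective) (h : R f) : R f' := by
  classical
  obtain ⟨d, hd⟩ : ∃ d, (Finset.univ.image f' \ Finset.univ.image f).card = d := ⟨_, rfl⟩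
  induction d generalizing f with
  | zero =>
    refine hR f f' hf hf' (Eq.symm ?_) h
    have hsub := Finset.sdiff_eq_empty_iff_subset.1 (Finset.card_eq_zero.1 hd)
    have heq := Finset.eq_of_subset_of_card_le hsub
      (by rw [Finset.card_image_of_injective _ hf, Finset.card_image_of_injective _ hf'])
    simpa using congrArg (fun S : Finset α => (S : Set α)) heq
  | succ d ih =>
    obtain ⟨j, hj⟩ : (Finset.univ.image f' \ Finset.univ.image f).Nonempty :=
      Finset.card_pos.1 (by omega)
    obtain ⟨i, hi⟩ : (Finset.univ.image f \ Finset.univ.image f').Nonempty := by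
      refine Finset.card_pos.1 ?_
      rw [Finset.card_sdiff_comm (by
        rw [Finset.card_image_of_injective _ hf, Finset.card_image_of_injective _ hf']), hd]
      omega
    rw [Finset.mem_sdiff] at hi hj
    obtain ⟨p, -, rfl⟩ := Finset.mem_image.1 hi.1
    have hrange : Set.range (fun a => f (p.succAbove a)) = Set.range f \ {f p} := by
      ext y
      constructor
      · rintro ⟨a, rfl⟩
        exact ⟨⟨_, rfl⟩, fun h => Fin.succAbove_ne p a (hf h)⟩
      · rintro ⟨⟨a, rfl⟩, hne⟩
        obtain ⟨b, hb⟩ := Fin.exists_succAbove_eq (x := a) (y := p) fun h => hne (by rw [h]; rfl)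
        exact ⟨b, by simp [hb]⟩
    set g : Fin m → α := fun a => f (p.succAbove a) with hg
    have hginj : g.Injective := hf.comp (Fin.succAbove_right_injective)
    have hjf : j ∉ Set.range f := by simpa using hj.2
    have hpg : f p ∉ Set.range g := by simp [hrange]
    have hjg : j ∉ Set.range g := by
      rw [hrange]
      exact fun h => hjf h.1
    have hij : f p ≠ j := fun h => hjf ⟨p, h⟩
    have hcons : ∀ y, y ∉ Set.range g → (Fin.cons y g : Fin (m + 1) → α).Injective := fun y hy =>
      Fin.cons_injective_iff.2 ⟨hy, hginj⟩
    refine ih (hcons j hjg) (hswap g (f p) j hginj hpg hjg hij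
      (hR f _ hf (hcons _ hpg) ?_ h)) ?_
    · rw [Fin.range_cons, hrange, Set.insert_sdiff_singleton,
        Set.insert_eq_of_mem (Set.mem_range_self p)]
    · have himage : Finset.univ.image (Fin.cons j g : Fin (m + 1) → α) =
          insert j ((Finset.univ.image f).erase (f p)) := by
        ext y
        have : y ∈ Set.range (Fin.cons j g : Fin (m + 1) → α) ↔
            y = j ∨ y ∈ Set.range f ∧ y ≠ f p := by
          rw [Fin.range_cons, hrange]
          rfl
        rw [← Finset.mem_coe, Finset.coe_image, Finset.coe_univ, Set.image_univ, this]
        simp [and_comm]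
      have : Finset.univ.image f' \ insert j ((Finset.univ.image f).erase (f p)) =
          (Finset.univ.image f' \ Finset.univ.image f).erase j := by
        ext y
        simp only [Finset.mem_sdiff, Finset.mem_insert, Finset.mem_erase, not_or, not_and]
        constructor
        · rintro ⟨h1, h2, h3⟩
          refine ⟨h2, h1, fun h4 => h3 ?_ h4⟩
          rintro rfl
          exact hi.2 h1
        · rintro ⟨h1, h2, h3⟩
          exact ⟨h2, h1, fun _ => h3⟩
      rw [himage, this, Finset.card_erase_of_mem (Finset.mem_sdiff.2 hj), hd]
      omega

end Transposition

theorem weightedDet_cons_mul_weightedDet_cons_pos {α : Type*} {m : ℕ} {φ : α → ℝ} (hφ : φ.Injective)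
    {w : α → Fin (m + 1) → ℝ} {g : Fin m → α} (hg : g.Injective) {i j : α}
    (h : 0 < (Matrix.of fun a => w ((Fin.cons i g : Fin (m + 1) → α) a)).det *
      (Matrix.of fun a => w ((Fin.cons j g : Fin (m + 1) → α) a)).det *
        ∏ x, (φ (g x) - φ i) * (φ (g x) - φ j)) :
    0 < weightedDet φ w (Fin.cons i g) * weightedDet φ w (Fin.cons j g) := by
  have hV : (Matrix.vandermonde (φ ∘ g)).det ≠ 0 :=
    Matrix.det_vandermonde_ne_zero_iff.2 (hφ.comp hg)
  rw [Finset.prod_mul_distrib] at h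
  rw [weightedDet_cons, weightedDet_cons]
  have := mul_pos h (pow_pos (abs_pos.2 hV) 2)
  rw [sq_abs] at this
  linarith

theorem mul_pos_of_mul_pos {ε a b : ℝ} (ha : 0 < ε * a) (hab : 0 < a * b) : 0 < ε * b := by
  have := mul_pos ha hab
  rw [show ε * a * (a * b) = a ^ 2 * (ε * b) by ring] at this
  exact pos_of_mul_pos_right this (sq_nonneg a)

section Necessity

variable {ι κ : Type*} [LinearOrder ι] [LinearOrder κ] [Fintype κ] {m : ℕ}
  {φ : ι → ℝ} {ψ : κ → ℝ} {v : ι → κ → ℝ}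

theorem not_weaklyAlternates_sum (H : ∀ u : κ → ℝ, u ≠ 0 → ¬ Alternates u (m + 1) →
      ¬ WeaklyAlternates (fun i => ∑ j, v i j * u j) (m + 1))
    {g : Fin (m + 1) → κ} (hg : g.Injective) {x : Fin (m + 1) → ℝ} (hx : x ≠ 0) :
    ¬ WeaklyAlternates (fun i => ∑ b, v i (g b) * x b) (m + 1) := by
  set u : κ → ℝ := fun j => ∑ b, if g b = j then x b else 0 with hu
  have hug : ∀ b, u (g b) = x b := fun b => by simp [hu, hg.eq_iff]
  have hsum : ∀ i, ∑ j, v i j * u j = ∑ b, v i (g b) * x b := by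
    intro i
    simp only [hu, Finset.mul_sum]
    rw [Finset.sum_comm]
    simp
  have := H u (fun h => hx (by ext b; rw [← hug, h]; rfl))
    (not_alternates_of_support (g := g) fun j hj => by
      obtain ⟨b, -, hb⟩ := Finset.exists_ne_zero_of_sum_ne_zero hj
      by_contra hcon
      exact hb (if_neg fun h => hcon ⟨b, h⟩))
  simpa only [hsum] using this

variable [Infinite ι]

theorem det_ne_zero_of_not_weaklyAlternates (hφ : StrictMono φ)
    (H : ∀ u : κ → ℝ, u ≠ 0 → ¬ Alternates u (m + 1) →
      ¬ WeaklyAlternates (fun i => ∑ j, v i j * u j) (m + 1))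
    {f : Fin (m + 1) → ι} (hf : f.Injective) {g : Fin (m + 1) → κ} (hg : g.Injective) :
    (Matrix.of fun a b => v (f a) (g b)).det ≠ 0 := by
  intro h
  obtain ⟨x, hx, hx0⟩ := Matrix.exists_mulVec_eq_zero_iff.2 h
  exact not_weaklyAlternates_sum H hg hx (weaklyAlternates_of_zero hφ hf fun a => congrFun hx0 a)

theorem weightedDet_row_swap_pos (hφ : StrictMono φ)
    (H : ∀ u : κ → ℝ, u ≠ 0 → ¬ Alternates u (m + 1) →
      ¬ WeaklyAlternates (fun i => ∑ j, v i j * u j) (m + 1))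
    {g : Fin (m + 1) → κ} (hg : g.Injective) {f : Fin m → ι} (hf : f.Injective) {i j : ι}
    (hi : i ∉ Set.range f) (hj : j ∉ Set.range f) (hij : i ≠ j) :
    0 < weightedDet φ (fun s b => v s (g b)) (Fin.cons i f) *
      weightedDet φ (fun s b => v s (g b)) (Fin.cons j f) := by
  refine weightedDet_cons_mul_weightedDet_cons_pos hφ.injective hf ?_
  set D : ι → ℝ := fun s => (Matrix.of fun a b =>
    v ((Fin.cons s f : Fin (m + 1) → ι) a) (g b)).det with hD
  change 0 < D i * D j * _
  set x : Fin (m + 1) → ℝ := fun b =>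
    (-1) ^ (b : ℕ) * (Matrix.of fun a b' => v (f a) (g (b.succAbove b'))).det with hx
  have hDx : ∀ s, D s = ∑ b, v s (g b) * x b := by
    intro s
    simp only [hD, hx]
    rw [Matrix.det_succ_row_zero]
    refine Finset.sum_congr rfl fun b _ => ?_
    rw [mul_left_comm, ← mul_assoc]
    rfl
  have hDi : D i ≠ 0 :=
    det_ne_zero_of_not_weaklyAlternates hφ H (Fin.cons_injective_iff.2 ⟨hi, hf⟩) hg
  by_contra hcon
  refine not_weaklyAlternates_sum H hg (x := x) (fun h => hDi (by simp [hDx, h])) ?_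
  simp only [← hDx]
  refine weaklyAlternates_of_prod_nonpos hφ hf hi hj hij (fun a => ?_) (not_lt.1 hcon)
  exact Matrix.det_zero_of_row_eq (Fin.succ_ne_zero a).symm (by ext b; simp)

theorem weightedDet_column_swap_pos (hφ : StrictMono φ) (hψ : StrictMono ψ)
    (H : ∀ u : κ → ℝ, u ≠ 0 → ¬ Alternates u (m + 1) →
      ¬ WeaklyAlternates (fun i => ∑ j, v i j * u j) (m + 1))
    {f : Fin (m + 1) → ι} (hf : f.Injective) {g : Fin m → κ} (hg : g.Injective) {i j : κ}
    (hi : i ∉ Set.range g) (hj : j ∉ Set.range g) (hij : i ≠ j) :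
    0 < weightedDet ψ (fun s a => v (f a) s) (Fin.cons i g) *
      weightedDet ψ (fun s a => v (f a) s) (Fin.cons j g) := by
  refine weightedDet_cons_mul_weightedDet_cons_pos hψ.injective hg ?_
  set M : κ → Matrix (Fin (m + 1)) (Fin (m + 1)) ℝ := fun s => Matrix.of fun a b =>
    v (f a) ((Fin.cons s g : Fin (m + 1) → κ) b) with hM
  have hMt : ∀ s, (Matrix.of fun b a => v (f a) ((Fin.cons s g : Fin (m + 1) → κ) b)).det =
      (M s).det := fun s => by rw [← Matrix.det_transpose]; rfl
  rw [hMt, hMt]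
  have hgi : (Fin.cons i g : Fin (m + 1) → κ).Injective := Fin.cons_injective_iff.2 ⟨hi, hg⟩
  have hMi : (M i).det ≠ 0 := det_ne_zero_of_not_weaklyAlternates hφ H hf hgi
  set x := (M i).cramer (fun a => v (f a) j) with hx
  have hx0 : x 0 = (M j).det := by
    rw [hx, Matrix.cramer_apply]
    congr 1
    ext a b
    refine Fin.cases ?_ (fun b => ?_) b <;> simp [hM]
  set u : κ → ℝ := fun s => (if j = s then (M i).det else 0) -
    ∑ b, if (Fin.cons i g : Fin (m + 1) → κ) b = s then x b else 0 with hu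
  have hu_i : u i = -(M j).det := by
    have : ∀ b, g b ≠ i := fun b h => hi ⟨b, h⟩
    simp [hu, hij.symm, Fin.sum_univ_succ, hx0, this]
  have hu_j : u j = (M i).det := by
    have : ∀ b, g b ≠ j := fun b h => hj ⟨b, h⟩
    simp [hu, hij, Fin.sum_univ_succ, this]
  by_contra hcon
  refine H u (fun h => hMi (by rw [← hu_j, h]; rfl)) ?_ (weaklyAlternates_of_zero hφ hf fun a => ?_)
  · refine not_alternates_of_prod_nonneg hψ hg hi hj hij (fun s hs => ?_) ?_
    · by_contra! hne
      refine hs ?_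
      have : ∀ b, g b ≠ s := fun b h => hne.2.2 ⟨b, h⟩
      simp [hu, hne.1.symm, hne.2.1.symm, Fin.sum_univ_succ, this]
    · rw [hu_i, hu_j]
      linarith
  · have h1 : ∑ s, v (f a) s * u s = (M i).det * v (f a) j - (M i).mulVec x a := by
      simp only [hu, mul_sub, Finset.sum_sub_distrib, Finset.mul_sum]
      rw [Finset.sum_comm]
      simp [Matrix.mulVec, dotProduct, hM, mul_comm]
    rw [h1, hx, Matrix.mulVec_cramer]
    simp

theorem exists_sign_of_not_weaklyAlternates (hφ : StrictMono φ) (hψ : StrictMono ψ)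
    (H : ∀ u : κ → ℝ, u ≠ 0 → ¬ Alternates u (m + 1) →
      ¬ WeaklyAlternates (fun i => ∑ j, v i j * u j) (m + 1))
    {f₀ : Fin (m + 1) → ι} (hf₀ : StrictMono f₀) {g₀ : Fin (m + 1) → κ} (hg₀ : StrictMono g₀) :
    ∃ ε : ℝ, (ε = 1 ∨ ε = -1) ∧ ∀ (f : Fin (m + 1) → ι) (g : Fin (m + 1) → κ), StrictMono f →
      StrictMono g → 0 < ε * (Matrix.of fun a b => v (f a) (g b)).det := by
  have hne := det_ne_zero_of_not_weaklyAlternates hφ H hf₀.injective hg₀.injective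
  obtain ⟨ε, hε, h0⟩ : ∃ ε : ℝ, (ε = 1 ∨ ε = -1) ∧
      0 < ε * (Matrix.of fun a b => v (f₀ a) (g₀ b)).det := by
    rcases lt_or_gt_of_ne hne with h | h
    · exact ⟨-1, Or.inr rfl, by linarith⟩
    · exact ⟨1, Or.inl rfl, by linarith⟩
  refine ⟨ε, hε, fun f g hf hg => ?_⟩
  have h1 : 0 < ε * (Matrix.of fun a b => v (f a) (g₀ b)).det := by
    rw [← mul_weightedDet_pos_iff hφ (fun s b => v s (g₀ b)) hf]
    rw [← mul_weightedDet_pos_iff hφ (fun s b => v s (g₀ b)) hf₀] at h0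
    refine of_cons_swap (R := fun f => 0 < ε * weightedDet φ (fun s b => v s (g₀ b)) f)
      (fun f f' hf hf' h => ?_) (fun f i j hf hi hj hij h => ?_) hf₀.injective hf.injective h0
    · rw [weightedDet_eq_of_range_eq _ hf hf' h]
      exact id
    · exact mul_pos_of_mul_pos h (weightedDet_row_swap_pos hφ H hg₀.injective hf hi hj hij)
  have htr : ∀ g : Fin (m + 1) → κ, (Matrix.of fun a b => v (f a) (g b)).det =
      (Matrix.of fun b a => v (f a) (g b)).det := fun g => by rw [← Matrix.det_transpose]; rfl
  rw [htr] at h1 ⊢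
  rw [← mul_weightedDet_pos_iff hψ (fun s a => v (f a) s) hg]
  rw [← mul_weightedDet_pos_iff hψ (fun s a => v (f a) s) hg₀] at h1
  refine of_cons_swap (R := fun g => 0 < ε * weightedDet ψ (fun s a => v (f a) s) g)
    (fun g g' hg hg' h => ?_) (fun g i j hg hi hj hij h => ?_) hg₀.injective hg.injective h1
  · rw [weightedDet_eq_of_range_eq _ hg hg' h]
    exact id
  · exact mul_pos_of_mul_pos h (weightedDet_column_swap_pos hφ hψ H hf.injective hg hi hj hij)

end Necessity

theorem mul_det_submatrix_pos_of_intervals {N n k : ℕ} (hk : 1 ≤ k)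
    (X : Matrix (Fin N) (Fin n) ℝ) (ε : ℝ)
    (h : ∀ (F : Fin k → Fin N) (G : Fin k → Fin n) (r t r' t' : ℕ), 1 ≤ r → r ≤ k → k - r ≤ t →
      t + r ≤ N → 1 ≤ r' → r' ≤ k → k - r' ≤ t' → t' + r' ≤ n →
      (∀ a : Fin k, (F a : ℕ) = if (a : ℕ) < k - r then (a : ℕ) else (a : ℕ) - (k - r) + t) →
      (∀ a : Fin k, (G a : ℕ) = if (a : ℕ) < k - r' then (a : ℕ) else (a : ℕ) - (k - r') + t') →
      0 < ε * (X.submatrix F G).det)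
    (f : Fin k → Fin N) (g : Fin k → Fin n) (hf : StrictMono f) (hg : StrictMono g) :
    0 < ε * (X.submatrix f g).det := by
  have hlt : ∀ {K r t : ℕ} (a : Fin k), r ≤ k → k - r ≤ t → t + r ≤ K →
      (if (a : ℕ) < k - r then (a : ℕ) else (a : ℕ) - (k - r) + t) < K := by
    intro K r t a _ _ _
    have := a.isLt
    split_ifs <;> omega
  have hcol : ∀ (F : Fin k → Fin N) (r t : ℕ), 1 ≤ r → r ≤ k → k - r ≤ t → t + r ≤ N →
      (∀ a : Fin k, (F a : ℕ) = if (a : ℕ) < k - r then (a : ℕ) else (a : ℕ) - (k - r) + t) →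
      0 < ε * (X.submatrix F g).det := by
    intro F r t hr1 hrk hrt htN hF
    have := mul_det_pos_of_intervals hk
      (fun j a => if hj : j < n then X (F a) ⟨j, hj⟩ else 0) ε (n := n)
      (fun r' t' hr' hrk' hrt' htn' => ?_) (fun b => (g b : ℕ)) hg (fun b => (g b).isLt)
    · rw [← Matrix.det_transpose]
      simp only [Fin.is_lt, dite_true, Fin.eta] at this
      exact this
    · have := h F (fun b => ⟨_, hlt b hrk' hrt' htn'⟩) r t r' t' hr1 hrk hrt htN hr' hrk' hrt' htn'
        hF fun _ => rfl
      rw [← Matrix.det_transpose] at this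
      convert this using 3
      ext b a
      simp [hlt b hrk' hrt' htn']
  have := mul_det_pos_of_intervals hk
    (fun i b => if hi : i < N then X ⟨i, hi⟩ (g b) else 0) ε (n := N)
    (fun r t hr hrk hrt htN => ?_) (fun a => (f a : ℕ)) hf (fun a => (f a).isLt)
  · simp only [Fin.is_lt, dite_true, Fin.eta] at this
    exact this
  · convert hcol (fun a => ⟨_, hlt a hrk hrt htN⟩) r t hr hrk hrt htN (fun _ => rfl) using 3
    ext a b
    simp [hlt a hrk hrt htN]

/-- the observability operator of an observable `(A,c)` is strictly
`(k-1)`-variation bounding iff all the indicated staircase minors of `O_N` share one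
strict sign. -/
theorem stmt2 {n : ℕ} (A : Matrix (Fin n) (Fin n) ℝ) (c : Fin n → ℝ) (k : ℕ)
    (hobs : Observable A c) (hk : 1 ≤ k) (hkn : k ≤ n) :
    ObsSVB A c (k - 1) ↔
      ∃ ε : ℝ, (ε = 1 ∨ ε = -1) ∧
        ∀ N : ℕ, k ≤ N → ∀ r ∈ Finset.Icc 1 k, ∀ t ∈ Finset.Icc 1 (N - k + 1),
          ∀ rb ∈ Finset.Icc 1 k, ∀ tb ∈ Finset.Icc (k - rb + 1) (n - rb + 1),
            ∀ (f : Fin k → Fin N) (g : Fin k → Fin n),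
              (∀ i : Fin k, (f i : ℕ) =
                if (i : ℕ) < k - r then (i : ℕ) else (i : ℕ) + t - 1) →
              (∀ i : Fin k, (g i : ℕ) =
                if (i : ℕ) < k - rb then (i : ℕ) else (i : ℕ) + tb - 1 - (k - rb)) →
              0 < ε * ((obsMat A c N).submatrix f g).det := by
  constructor
  · intro hO
    obtain ⟨m, rfl⟩ : ∃ m, k = m + 1 := ⟨k - 1, by omega⟩
    have H : ∀ u : Fin n → ℝ, u ≠ 0 → ¬ Alternates u (m + 1) →
        ¬ WeaklyAlternates (fun i : ℕ => ∑ j, Matrix.vecMul c (A ^ i) j * u j) (m + 1) := by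
      rintro u hu hua ⟨s, hs, σ, hσ, hσs⟩
      refine (svb_pred_iff hk _).1 (hO (s (Fin.last _) + 1) (Nat.succ_pos _)) u hu hua
        ⟨fun j => ⟨s j, Nat.lt_succ_of_le (hs.monotone (Fin.le_last j))⟩, fun _ _ hab => hs hab,
          σ, hσ, hσs⟩
    obtain ⟨ε, hε, hpos⟩ := exists_sign_of_not_weaklyAlternates (φ := fun i : ℕ => (i : ℝ))
      (ψ := fun j : Fin n => ((j : ℕ) : ℝ)) Nat.strictMono_cast
      (fun _ _ hab => Nat.cast_lt.2 hab) H Fin.val_strictMono (Fin.strictMono_castLE hkn)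
    refine ⟨ε, hε, fun N hN r hr t ht rb hrb tb htb f g hf hg => ?_⟩
    rw [Finset.mem_Icc] at hr ht hrb htb
    refine hpos (fun a => (f a : ℕ)) g (fun a b hab => ?_) (fun a b hab => ?_)
    · have : (a : ℕ) < b := hab
      simp only [hf]
      split_ifs <;> omega
    · have : (a : ℕ) < b := hab
      rw [Fin.lt_def, hg, hg]
      split_ifs <;> omega
  · rintro ⟨ε, -, h⟩ N hN
    refine (svb_pred_iff hk _).2 fun u hu hua => ?_
    rcases lt_or_ge N k with hNk | hkN
    · rintro ⟨s, hs, -⟩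
      have := Fintype.card_le_of_injective s hs.injective
      simp only [Fintype.card_fin] at this
      omega
    · refine not_weaklyAlternates_of_minors_pos hk hkn _ (ε := ε)
        (mul_det_submatrix_pos_of_intervals hk _ ε ?_) u hu hua
      intro F G r t r' t' hr hrk hrt htN hr' hrk' hrt' htn' hF hG
      refine h N hkN r (Finset.mem_Icc.2 ⟨hr, hrk⟩) (t + 1 - (k - r))
        (Finset.mem_Icc.2 ⟨by omega, by omega⟩) r' (Finset.mem_Icc.2 ⟨hr', hrk'⟩) (t' + 1)
        (Finset.mem_Icc.2 ⟨by omega, by omega⟩) F G (fun a => ?_) fun a => ?_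
      · rw [hF]
        split_ifs <;> omega
      · rw [hG]
        split_ifs <;> omega
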